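/- Let p, q ≥ 1, let (x,u) ∈ L be in the monotone extended second order cone, let (y,v) ∈ M, and assume u ≠ 0 and v ≠ 0. Then ⟨(x,u),(y,v)⟩ = 0 if and only if ⟨x,y⟩ = ‖u‖·∑_{i=1}^{p} yᵢ, ∑_{i=1}^{p} yᵢ = ‖v‖, and there exists λ > 0 such that v = −λu. -/

import Mathlib

open Finset RealInnerProductSpace

/-- The monotone extended second order cone (MESOC)
`L = {(x,u) ∈ ℝᵖ×ℝᵠ : x₁ ≥ x₂ ≥ ⋯ ≥ x_p ≥ ‖u‖}`. -/
def MESOC (p q : ℕ) : Set (EuclideanSpace ℝ (Fin p) × EuclideanSpace ℝ (Fin q)) :=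
  {z | (∀ i j : Fin p, i ≤ j → z.1 j ≤ z.1 i) ∧ ∀ i : Fin p, ‖z.2‖ ≤ z.1 i}

/-- The dual cone `M` of the MESOC, described explicitly. -/
def MESOCdual (p q : ℕ) : Set (EuclideanSpace ℝ (Fin p) × EuclideanSpace ℝ (Fin q)) :=
  {w | (∀ j : Fin p, (j : ℕ) + 1 < p → 0 ≤ ∑ i ∈ Finset.Iic j, w.1 i) ∧
    ‖w.2‖ ≤ ∑ i, w.1 i}

theorem abel_aux : ∀ (n : ℕ) (x y : Fin n → ℝ) (c : ℝ),
    (∀ i j : Fin n, i ≤ j → x j ≤ x i) → (∀ i, c ≤ x i) →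
    (∀ j : Fin n, 0 ≤ ∑ i ∈ Finset.Iic j, y i) → c * ∑ i, y i ≤ ∑ i, x i * y i := by
  intro n
  induction n with
  | zero => intro x y c _ _ _; simp
  | succ n ih =>
    intro x y c hx hc hy
    have h1 := ih (fun i => x i.castSucc) (fun i => y i.castSucc) (x (Fin.last n))
      (fun i j hij => hx _ _ (by simpa using hij))
      (fun i => hx _ _ (Fin.le_last _))
      (fun j => by
        have := hy j.castSucc
        rw [← Fin.map_castSuccEmb_Iic, Finset.sum_map] at this
        simpa using this)
    have h2 : 0 ≤ ∑ i, y i := by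
      have := hy (Fin.last n)
      have e : Finset.Iic (Fin.last n) = Finset.univ := by
        ext i; simp [Fin.le_last]
      rwa [e] at this
    have h3 := mul_le_mul_of_nonneg_right (hc (Fin.last n)) h2
    rw [Fin.sum_univ_castSucc (fun i => x i * y i)]
    rw [Fin.sum_univ_castSucc y] at h3 ⊢
    linarith

/-- First characterization of the complementarity set of the MESOC: for `(x,u) ∈ L`,
`(y,v) ∈ M` with `u ≠ 0 ≠ v`, one has `⟨(x,u),(y,v)⟩ = 0` iff `⟨x,y⟩ = ‖u‖·∑ᵢ yᵢ`,
`∑ᵢ yᵢ = ‖v‖` and `v = -λu` for some `λ > 0`. -/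
theorem mesoc_complementarity_first (p q : ℕ) (hp : 1 ≤ p) (hq : 1 ≤ q)
    (z w : EuclideanSpace ℝ (Fin p) × EuclideanSpace ℝ (Fin q))
    (hz : z ∈ MESOC p q) (hw : w ∈ MESOCdual p q)
    (hu : z.2 ≠ 0) (hv : w.2 ≠ 0) :
    ⟪z.1, w.1⟫ + ⟪z.2, w.2⟫ = 0 ↔
      ⟪z.1, w.1⟫ = ‖z.2‖ * ∑ i, w.1 i ∧ (∑ i, w.1 i) = ‖w.2‖ ∧
        ∃ l : ℝ, 0 < l ∧ w.2 = -(l • z.2) := by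
  obtain ⟨hx, hc⟩ := hz
  obtain ⟨hy, hs⟩ := hw
  have hun : 0 < ‖z.2‖ := norm_pos_iff.mpr hu
  have hvn : 0 < ‖w.2‖ := norm_pos_iff.mpr hv
  have hy' : ∀ j : Fin p, 0 ≤ ∑ i ∈ Finset.Iic j, w.1 i := by
    intro j
    by_cases hj : (j : ℕ) + 1 < p
    · exact hy j hj
    · have e : Finset.Iic j = Finset.univ := by
        ext i
        simp only [Finset.mem_Iic, Finset.mem_univ, iff_true, Fin.le_def]
        omega
      rw [e]
      exact hvn.le.trans hs
  have hA := abel_aux p (fun i => z.1 i) (fun i => w.1 i) ‖z.2‖ hx hc hy'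
  have hin : ⟪z.1, w.1⟫ = ∑ i, z.1 i * w.1 i := by
    simp [PiLp.inner_apply, mul_comm]
  rw [← hin] at hA
  have hB := mul_le_mul_of_nonneg_left hs hun.le
  have hC : -(‖z.2‖ * ‖w.2‖) ≤ ⟪z.2, w.2⟫ := by
    have := abs_real_inner_le_norm z.2 w.2
    exact (abs_le.mp this).1
  constructor
  · intro h
    refine ⟨by linarith, ?_, ‖w.2‖ / ‖z.2‖, by positivity, ?_⟩
    · exact mul_left_cancel₀ hun.ne' (by linarith)
    · have hD : ⟪-z.2, w.2⟫ = ‖-z.2‖ * ‖w.2‖ := by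
        rw [inner_neg_left, norm_neg]; linarith
      rw [inner_eq_norm_mul_iff_real, norm_neg] at hD
      rw [div_eq_inv_mul, mul_smul, ← smul_neg, ← smul_neg, hD, smul_smul,
        inv_mul_cancel₀ hun.ne', one_smul]
  · rintro ⟨h1, h2, l, hl, h3⟩
    rw [h1, h2, h3, inner_neg_right, inner_smul_right, real_inner_self_eq_norm_sq, norm_neg,
      norm_smul, Real.norm_of_nonneg hl.le]
    ring
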